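/- For every pair of indices 0 ≤ i < j ≤ t−1 and every integer k with |k| ≤ a−1, the polynomial (x_i − x_j + k)^{a−|k|} divides det A in ℂ[x₀,…,x_{t−1}]. -/

import Mathlib

open Finset

/-- Binomial polynomial `C(y,n) = y(y−1)⋯(y−n+1)/n!` for `n ≥ 0`, and `0` for `n < 0`. -/
noncomputable def polyBinom (t : ℕ) (y : MvPolynomial (Fin t) ℂ) (n : ℤ) :
    MvPolynomial (Fin t) ℂ :=
  if 0 ≤ n then
    ((n.toNat.factorial : ℂ)⁻¹) • ∏ j ∈ Finset.range n.toNat, (y - (j : MvPolynomial (Fin t) ℂ))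
  else 0

/-- `α_i^k(x_s) = Σ_{j=1}^{k} C(x_s, i+j)·C(−x_s, k−j)`. -/
noncomputable def alphaP (t : ℕ) (s : Fin t) (k : ℕ) (i : ℤ) : MvPolynomial (Fin t) ℂ :=
  ∑ j ∈ Finset.Icc 1 k,
    polyBinom t (MvPolynomial.X s) (i + j) * polyBinom t (-(MvPolynomial.X s)) ((k : ℤ) - j)

/-- The `(at)×(at)` matrix `A = (A₀ ⋯ A_{t−1})`: rows and columns are indexed by
`Fin t × Fin a` via the bijection `(v,w) ↦ v·a + w + 1` (1-based); the entry in global row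
`u = v·a + w + 1` and column `(s, k)` (block `s`, inner column `k+1`) is
`α^{k+1}_{(t−1)a−u}(x_s)`. -/
noncomputable def matA (t a : ℕ) :
    Matrix (Fin t × Fin a) (Fin t × Fin a) (MvPolynomial (Fin t) ℂ) :=
  Matrix.of fun u c =>
    alphaP t c.1 (c.2.val + 1) (((t : ℤ) - 1) * a - ((u.1.val : ℤ) * a + u.2.val + 1))

theorem polyBinom_natCast {t : ℕ} (y : MvPolynomial (Fin t) ℂ) (n : ℕ) :
    polyBinom t y n = ((n.factorial : ℂ)⁻¹) •
      ∏ j ∈ Finset.range n, (y - (j : MvPolynomial (Fin t) ℂ)) := by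
  simp [polyBinom]

theorem polyBinom_of_neg {t : ℕ} (y : MvPolynomial (Fin t) ℂ) {n : ℤ} (hn : n < 0) :
    polyBinom t y n = 0 := by
  simp [polyBinom, hn]

/-- Pascal's rule in the form of a forward difference. -/
theorem fwdDiff_polyBinom (t : ℕ) (n : ℤ) :
    fwdDiff 1 (fun y => polyBinom t y n) = fun y => polyBinom t y (n - 1) := by
  funext y
  rw [fwdDiff]
  rcases lt_or_ge n 0 with hn | hn
  · rw [polyBinom_of_neg _ hn, polyBinom_of_neg _ hn, polyBinom_of_neg _ (by omega), sub_zero]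
  lift n to ℕ using hn
  cases n with
  | zero => simp [polyBinom]
  | succ n =>
    have hpred : ((n + 1 : ℕ) : ℤ) - 1 = n := by push_cast; ring
    rw [hpred, polyBinom_natCast, polyBinom_natCast, polyBinom_natCast, Finset.prod_range_succ',
      Finset.prod_range_succ, ← smul_sub]
    have hshift : ∀ j : ℕ, y + 1 - ((j + 1 : ℕ) : MvPolynomial (Fin t) ℂ) = y - j := by
      intro j; push_cast; ring
    simp only [hshift]
    have hfactor : ((∏ j ∈ Finset.range n, (y - (j : MvPolynomial (Fin t) ℂ))) *
        (y + 1 - ((0 : ℕ) : MvPolynomial (Fin t) ℂ)) -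
        (∏ j ∈ Finset.range n, (y - (j : MvPolynomial (Fin t) ℂ))) * (y - n)) =
        ((n + 1 : ℕ) : ℂ) • ∏ j ∈ Finset.range n, (y - (j : MvPolynomial (Fin t) ℂ)) := by
      rw [Nat.cast_smul_eq_nsmul, nsmul_eq_mul]
      push_cast
      ring
    rw [hfactor, smul_smul, Nat.factorial_succ]
    congr 1
    have : ((n + 1 : ℕ) : ℂ) ≠ 0 := Nat.cast_ne_zero.mpr n.succ_ne_zero
    rw [Nat.cast_mul]
    field_simp

theorem fwdDiff_iterate_polyBinom (t : ℕ) (n : ℤ) (i : ℕ) :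
    (fwdDiff 1)^[i] (fun y => polyBinom t y n) = fun y => polyBinom t y (n - i) := by
  induction i with
  | zero => simp
  | succ i ih =>
    rw [Function.iterate_succ_apply', ih, fwdDiff_polyBinom]
    funext y
    congr 1
    push_cast
    ring

/-- `C(y, n - i)` is a combination of `C(y + m, n)`, `m < a`, with coefficients
independent of `n` and `y`. -/
theorem polyBinom_sub_eq_sum {t a i : ℕ} (hi : i < a) (y : MvPolynomial (Fin t) ℂ) (n : ℤ) :
    polyBinom t y (n - i) =
      ∑ m ∈ Finset.range a, ((-1) ^ (i - m) * (i.choose m : ℤ)) • polyBinom t (y + m) n := by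
  have h := congrFun (fwdDiff_iterate_polyBinom t n i) y
  rw [fwdDiff_iter_eq_sum_shift] at h
  rw [← h]
  simp only [nsmul_one]
  apply Finset.sum_subset (Finset.range_subset_range.mpr hi)
  intro m _ hm
  rw [Nat.choose_eq_zero_of_lt (by simpa using hm)]
  simp

theorem polyBinom_eq_sum_pow {t n N : ℕ} (hn : n < N) (y : MvPolynomial (Fin t) ℂ) :
    polyBinom t y n = ∑ l ∈ Finset.range N,
      (((n.factorial : ℂ)⁻¹) • (descPochhammer (MvPolynomial (Fin t) ℂ) n).coeff l) * y ^ l := by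
  rw [polyBinom_natCast, ← descPochhammer_eval_eq_prod_range,
    Polynomial.eval_eq_sum_range' (by rwa [descPochhammer_natDegree]), Finset.smul_sum]
  simp only [smul_mul_assoc]

/-- The entries of `matA` as combinations of `C(x_s + m, n)`, `m < a`. -/
theorem alphaP_sub_eq_sum {t a k : ℕ} (hk : k ≤ a) (s : Fin t) (n : ℤ) :
    alphaP t s k (n - a) = ∑ m ∈ Finset.range a, polyBinom t (MvPolynomial.X s + (m : MvPolynomial (Fin t) ℂ)) n *
      ∑ j ∈ Finset.Icc 1 k, ((-1) ^ (a - j - m) * ((a - j).choose m : ℤ)) •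
        polyBinom t (-(MvPolynomial.X s)) ((k : ℤ) - j) := by
  simp only [Finset.mul_sum]
  rw [Finset.sum_comm, alphaP]
  refine Finset.sum_congr rfl fun j hj => ?_
  rw [Finset.mem_Icc] at hj
  have hidx : n - a + j = n - ((a - j : ℕ) : ℤ) := by omega
  rw [hidx, polyBinom_sub_eq_sum (a := a) (by omega), Finset.sum_mul]
  refine Finset.sum_congr rfl fun m _ => ?_
  rw [smul_mul_assoc, mul_smul_comm]

theorem det_vandermonde_dvd_det_matA (t a : ℕ) :
    (Matrix.vandermonde fun q : Fin (t * a) =>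
      (MvPolynomial.X (finProdFinEquiv.symm q).1 + (((finProdFinEquiv.symm q).2 : ℕ) : MvPolynomial (Fin t) ℂ) :
        MvPolynomial (Fin t) ℂ)).det ∣ (matA t a).det := by
  set V := Matrix.vandermonde fun q : Fin (t * a) =>
      (MvPolynomial.X (finProdFinEquiv.symm q).1 + (((finProdFinEquiv.symm q).2 : ℕ) : MvPolynomial (Fin t) ℂ) :
        MvPolynomial (Fin t) ℂ) with hV
  let r : Fin t × Fin a → ℕ := fun u => t * a - 1 - finProdFinEquiv u
  let L : Matrix (Fin t × Fin a) (Fin t × Fin a) (MvPolynomial (Fin t) ℂ) := Matrix.of fun u p =>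
    (((r u).factorial : ℂ)⁻¹) •
      (descPochhammer (MvPolynomial (Fin t) ℂ) (r u)).coeff (finProdFinEquiv p).val
  let M : Matrix (Fin t × Fin a) (Fin t × Fin a) (MvPolynomial (Fin t) ℂ) := Matrix.of fun q c =>
    if q.1 = c.1 then
      ∑ j ∈ Finset.Icc 1 (c.2.val + 1),
        ((-1) ^ (a - j - q.2.val) * ((a - j).choose q.2.val : ℤ)) •
          polyBinom t (-(MvPolynomial.X c.1)) (((c.2.val + 1 : ℕ) : ℤ) - j)
    else 0
  have hfactor : matA t a = L * V.transpose.submatrix finProdFinEquiv finProdFinEquiv * M := by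
    ext1 u c
    have hrow : ((t : ℤ) - 1) * a - ((u.1.val : ℤ) * a + u.2.val + 1) = (r u : ℤ) - a := by
      have hlt := (finProdFinEquiv u).isLt
      have hval : ((finProdFinEquiv u : Fin (t * a)) : ℕ) = u.2.val + a * u.1.val := rfl
      have hr : (r u : ℤ) = (t : ℤ) * a - 1 - (u.2.val + a * u.1.val) := by
        simp only [r]
        rw [hval] at hlt ⊢
        rw [Nat.cast_sub (by omega), Nat.cast_sub (by omega)]
        push_cast
        ring
      rw [hr]
      ring
    have hpow : ∀ q : Fin t × Fin a,
        (L * V.transpose.submatrix finProdFinEquiv finProdFinEquiv) u q =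
          polyBinom t (MvPolynomial.X q.1 + (q.2.val : MvPolynomial (Fin t) ℂ)) (r u) := by
      intro q
      have hr : r u < t * a := by
        have := (finProdFinEquiv u).isLt
        simp only [r]
        omega
      rw [polyBinom_eq_sum_pow hr, Finset.sum_range, Matrix.mul_apply,
        ← (finProdFinEquiv (m := t) (n := a)).sum_comp]
      refine Finset.sum_congr rfl fun p _ => ?_
      simp only [L, hV, Matrix.of_apply, Matrix.submatrix_apply, Matrix.transpose_apply,
        Matrix.vandermonde_apply, Equiv.symm_apply_apply]
    rw [Matrix.mul_apply, Fintype.sum_prod_type]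
    simp only [hpow, M, Matrix.of_apply]
    rw [Finset.sum_eq_single c.1 (by intro s _ hs; simp [hs]) (by simp)]
    simp only [if_true]
    rw [matA, Matrix.of_apply, hrow, alphaP_sub_eq_sum (by omega), Finset.sum_range]
  rw [hfactor, Matrix.det_mul, Matrix.det_mul, Matrix.det_submatrix_equiv_self,
    Matrix.det_transpose]
  exact (dvd_mul_left _ _).mul_right _

/-- A common divisor of distinct factors of a Vandermonde determinant divides it with the
corresponding multiplicity. -/
theorem pow_dvd_det_vandermonde {R : Type*} [CommRing R] {n d : ℕ} (v : Fin n → R) (x : R)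
    (f g : Fin d → Fin n) (hf : Function.Injective f) (hlt : ∀ r, f r < g r)
    (hx : ∀ r, x ∣ v (g r) - v (f r)) : x ^ d ∣ (Matrix.vandermonde v).det := by
  rw [Matrix.det_vandermonde, Finset.prod_sigma']
  let F : Fin d → (_ : Fin n) × Fin n := fun r => ⟨f r, g r⟩
  have hF : Function.Injective F := fun r s h => hf (congrArg Sigma.fst h)
  calc x ^ d = ∏ _r : Fin d, x := by simp
    _ ∣ ∏ r : Fin d, (v (F r).2 - v (F r).1) := Finset.prod_dvd_prod_of_dvd _ _ fun r _ => hx r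
    _ = ∏ p ∈ Finset.univ.map ⟨F, hF⟩, (v p.2 - v p.1) := by simp
    _ ∣ _ := by
      apply Finset.prod_dvd_prod_of_subset
      intro p hp
      obtain ⟨r, -, rfl⟩ := Finset.mem_map.mp hp
      simpa [F] using hlt r

theorem stmt18 (t a : ℕ) (ht : 0 < t) (ha : 0 < a) (i j : Fin t) (hij : i < j)
    (k : ℤ) (hk : |k| ≤ (a : ℤ) - 1) :
    (MvPolynomial.X i - MvPolynomial.X j + MvPolynomial.C (k : ℂ)) ^ (a - k.natAbs) ∣
      (matA t a).det := by
  refine dvd_trans ?_ (det_vandermonde_dvd_det_matA t a)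
  refine pow_dvd_det_vandermonde _ _
    (fun r => finProdFinEquiv (i, ⟨r + k.toNat, by omega⟩))
    (fun r => finProdFinEquiv (j, ⟨r + (-k).toNat, by omega⟩)) ?_ ?_ ?_
  · intro r s h
    have h := finProdFinEquiv.injective h
    simp only [Prod.mk.injEq, Fin.mk.injEq, true_and] at h
    omega
  · intro r
    rw [Fin.lt_def]
    simp only [finProdFinEquiv_apply_val]
    have hmul : a * (i.val + 1) ≤ a * j.val := Nat.mul_le_mul_left a hij
    have hr := r.isLt
    rw [mul_add, mul_one] at hmul
    omega
  · intro r
    have hsplit : (MvPolynomial.C (k : ℂ) : MvPolynomial (Fin t) ℂ) =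
        (k.toNat : MvPolynomial (Fin t) ℂ) - ((-k).toNat : MvPolynomial (Fin t) ℂ) := by
      conv_lhs => rw [← Int.toNat_sub_toNat_neg k]
      rw [Int.cast_sub, map_sub, Int.cast_natCast, Int.cast_natCast, map_natCast, map_natCast]
    refine ⟨-1, ?_⟩
    simp only [Equiv.symm_apply_apply, hsplit]
    push_cast
    ring
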